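/- Let ⟨A, →⟩ be a conditional algebra that in addition satisfies (C3*) (a → c) ⊓ (b → c) ≤ (a ⊔ b) → c for all a, b, c ∈ A. Let F be a proper filter of A, H a filter of A, and u an ultrafilter of A. If D_H(F) ⊆ u, then there exists an ultrafilter v of A with F ⊆ v and D_H(v) ⊆ u. -/

import Mathlib

/-- A filter of a Boolean algebra: contains `⊤`, upward closed, closed under binary meets. -/
def IsBFilter {A : Type*} [BooleanAlgebra A] (F : Set A) : Prop :=
  ⊤ ∈ F ∧ (∀ a b : A, a ∈ F → a ≤ b → b ∈ F) ∧ (∀ a b : A, a ∈ F → b ∈ F → a ⊓ b ∈ F)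

/-- An ultrafilter: a maximal proper filter. -/
def IsBUltra {A : Type*} [BooleanAlgebra A] (u : Set A) : Prop :=
  IsBFilter u ∧ u ≠ Set.univ ∧
    ∀ F : Set A, IsBFilter F → F ≠ Set.univ → u ⊆ F → F = u

/-- `D_X(Y) = {b | ∃ a ∈ Y, a → b ∈ X}`. -/
def Dset {A : Type*} [BooleanAlgebra A] (c : A → A → A) (X Y : Set A) : Set A :=
  {b : A | ∃ a ∈ Y, c a b ∈ X}

/-- in a conditional algebra satisfying (C3*), if `D_H(F) ⊆ u` for a
proper filter `F`, then `D_H(v) ⊆ u` for some ultrafilter `v ⊇ F`. -/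
theorem statement16 {A : Type*} [BooleanAlgebra A] (c : A → A → A)
    (hC1 : ∀ a : A, c a ⊤ = ⊤)
    (hC2 : ∀ a b d : A, c a b ⊓ c a d = c a (b ⊓ d))
    (hC3 : ∀ a b d : A, c (a ⊔ b) d ≤ c a d ⊓ c b d)
    (hC3s : ∀ a b d : A, c a d ⊓ c b d ≤ c (a ⊔ b) d)
    (F H : Set A) (hF : IsBFilter F) (hFprop : F ≠ Set.univ) (hH : IsBFilter H)
    (u : Set A) (hu : IsBUltra u) (hDu : Dset c H F ⊆ u) :
    ∃ v : Set A, IsBUltra v ∧ F ⊆ v ∧ Dset c H v ⊆ u := by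
  have huprime : ∀ x y : A, x ⊔ y ∈ u → y ∉ u → x ∈ u := by
    intro x y hxy hy
    obtain ⟨⟨u1, u2, u3⟩, -, u5⟩ := hu
    have hG := u5 {z | z ⊔ y ∈ u} ⟨u2 _ _ u1 le_sup_left,
      fun a b ha hab => u2 _ _ ha (sup_le_sup_right hab y),
      fun a b ha hb => by
        show (a ⊓ b) ⊔ y ∈ u
        rw [sup_inf_right]
        exact u3 _ _ ha hb⟩
      (fun h => by
        have h0 : (⊥ : A) ∈ {z | z ⊔ y ∈ u} := h ▸ Set.mem_univ _
        have h1 : (⊥ : A) ⊔ y ∈ u := h0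
        rw [bot_sup_eq] at h1
        exact hy h1)
      (fun a ha => u2 _ _ ha le_sup_left)
    rw [← hG]
    exact hxy
  have cmono : ∀ a b d : A, b ≤ d → c a b ≤ c a d := by
    intro a b d h
    have := hC2 a b d
    rw [inf_eq_left.mpr h] at this
    exact inf_eq_left.mp this
  have canti : ∀ a b d : A, a ≤ b → c b d ≤ c a d := by
    intro a b d h
    have := hC3 a b d
    rw [sup_eq_right.mpr h] at this
    exact this.trans inf_le_left
  obtain ⟨F1, F2, F3⟩ := hF
  obtain ⟨H1, H2, H3⟩ := hH
  have hbotF : (⊥ : A) ∉ F := fun h =>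
    hFprop (Set.eq_univ_of_forall fun x => F2 _ _ h bot_le)
  let I : Order.Ideal A :=
    { carrier := {a | a = ⊥ ∨ ∃ b, b ∉ u ∧ c a b ∈ H}
      lower' := by
        rintro a b hba (rfl | ⟨d, hd, had⟩)
        · exact Or.inl (le_bot_iff.mp hba)
        · exact Or.inr ⟨d, hd, H2 _ _ had (canti _ _ _ hba)⟩
      nonempty' := ⟨⊥, Or.inl rfl⟩
      directed' := by
        rintro a ha b hb
        refine ⟨a ⊔ b, ?_, le_sup_left, le_sup_right⟩
        rcases ha with rfl | ⟨d, hd, had⟩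
        · rw [bot_sup_eq]
          exact hb
        · rcases hb with rfl | ⟨e, he, hbe⟩
          · rw [sup_bot_eq]
            exact Or.inr ⟨d, hd, had⟩
          · refine Or.inr ⟨d ⊔ e, fun h => hd (huprime d e h he), ?_⟩
            exact H2 _ _ (H3 _ _ (H2 _ _ had (cmono _ _ _ le_sup_left))
              (H2 _ _ hbe (cmono _ _ _ le_sup_right))) (hC3s _ _ _) }
  have hFf : Order.IsPFilter F := Order.IsPFilter.of_def ⟨⊤, F1⟩
    (fun a ha b hb => ⟨a ⊓ b, F3 _ _ ha hb, inf_le_left, inf_le_right⟩)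
    (fun {a b} hab ha => F2 _ _ ha hab)
  have hdis : Disjoint (hFf.toPFilter : Set A) (I : Set A) := by
    rw [Set.disjoint_left]
    intro a (ha : a ∈ F) hI
    rcases hI with rfl | ⟨b, hb, hab⟩
    · exact hbotF ha
    · exact hb (hDu ⟨a, ha, hab⟩)
  obtain ⟨J, hJ, hIJ, hFJ⟩ := DistribLattice.prime_ideal_of_disjoint_filter_ideal hdis
  have htop : (⊤ : A) ∉ J := fun h => Set.disjoint_left.mp hFJ (show (⊤ : A) ∈ F from F1) h
  refine ⟨{x | x ∉ J}, ⟨⟨htop, fun a b ha hab hb => ha (J.lower hab hb),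
    fun a b ha hb hab => (hJ.mem_or_mem hab).elim ha hb⟩, ?_, ?_⟩,
    fun x hx hxJ => Set.disjoint_left.mp hFJ (show x ∈ F from hx) hxJ, ?_⟩
  · intro h
    have : (⊥ : A) ∈ {x | x ∉ J} := h ▸ Set.mem_univ _
    exact this J.bot_mem
  · rintro G ⟨-, G2, G3⟩ hG hvG
    refine Set.Subset.antisymm (fun x hx hxJ => ?_) hvG
    have hxc : xᶜ ∈ G := hvG fun hc => htop (by
      have := Order.Ideal.sup_mem hxJ hc
      rwa [sup_compl_eq_top] at this)
    have hb := G3 _ _ hx hxc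
    rw [inf_compl_eq_bot] at hb
    exact hG (Set.eq_univ_of_forall fun z => G2 _ _ hb bot_le)
  · rintro b ⟨a, ha, hab⟩
    by_contra hb
    exact ha (hIJ (show a ∈ I from Or.inr ⟨b, hb, hab⟩))
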